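/- arXiv:1308.4637 — 3 statements merged into one kernel-verified Lean document; each statement's English description precedes it below -/
import Mathlib

section
/- Suppose M is a complex (not totally real) Galois extension of ℚ. Assume the p-adic Schanuel Conjecture. Then rk((log_p(σ_i(g_j(ε))))_{σ_i ∈ S_p, g_j ∈ G}) ≥ r − (t−1)^+. -/
open scoped NumberField
open Filter

/-- The `p`-adic logarithm on a complete normed field `Cp` (a stand-in for `ℂ_p`), defined by
the power series `log_p x = ∑_{k ≥ 1} (-1)^(k+1) (x-1)^k / k` (convergent for `‖x - 1‖ < 1`). -/
noncomputable def plog (Cp : Type*) [NormedField Cp] (x : Cp) : Cp :=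
  ∑' k : ℕ, (-1) ^ (k + 1 + 1) * (x - 1) ^ (k + 1) / ((k : Cp) + 1)

/-- The `p`-adic Schanuel conjecture. -/
def PadicSchanuel (Cp : Type*) [NormedField Cp] [CharZero Cp] : Prop :=
  ∀ (m : ℕ) (α : Fin m → Cp),
    (∀ i, IsAlgebraic ℚ (α i)) → (∀ i, ‖α i - 1‖ < 1) →
    LinearIndependent ℚ (fun i => plog Cp (α i)) →
    AlgebraicIndependent ℚ (fun i => plog Cp (α i))

/-- The matrix `(log_p (σ (g ε)))` with rows indexed by `S_p ⊆ E_p` and columns by `G`. -/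
noncomputable def padicLogMatrix (Cp : Type*) [NormedField Cp] (M : Type*) [Field M]
    [NumberField M] (S : Set (M →+* Cp)) (ε : M) : Matrix S (M ≃ₐ[ℚ] M) Cp :=
  fun σ g => plog Cp (σ.1 (g ε))

/-- `ε ∈ O_M^*` is a weak Minkowski unit. -/
def IsWeakMinkowskiUnit (M : Type*) [Field M] [NumberField M] (ε : (𝓞 M)ˣ) : Prop :=
  ∃ u : (M ≃ₐ[ℚ] M) → (𝓞 M)ˣ,
    (∀ g, algebraMap (𝓞 M) M (u g) = g (algebraMap (𝓞 M) M ε)) ∧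
    (Subgroup.closure (Set.range u)).FiniteIndex

/-- `c ∈ G` is induced by complex conjugation: `τ ∘ c = conj ∘ τ` for some `τ ∈ E`. -/
def InducedByConj (M : Type*) [Field M] [NumberField M] (g : M ≃ₐ[ℚ] M) : Prop :=
  ∃ τ : M →+* ℂ, ∀ x : M, τ (g x) = (starRingEnd ℂ) (τ x)

/-- `J_σ = {g ∈ G : σ ∘ g ∈ E_p ∖ S_p}`. -/
def Jset (Cp : Type*) [Field Cp] (M : Type*) [Field M] [NumberField M]
    (Sp : Set (M →+* Cp)) (σ : M →+* Cp) : Set (M ≃ₐ[ℚ] M) :=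
  {g | σ.comp (g : M →+* M) ∉ Sp}

/-- `t_c`: the number of right cosets `{g, cg}` of `{id, c}` contained in `J`. -/
noncomputable def tcos {M : Type*} [Field M] [NumberField M] (c : M ≃ₐ[ℚ] M)
    (J : Set (M ≃ₐ[ℚ] M)) : ℕ :=
  Set.ncard {s : Set (M ≃ₐ[ℚ] M) | (∃ g, s = {g, c * g}) ∧ s ⊆ J}

theorem norm_mul_sub_one_lt {K : Type*} [NormedField K] [IsUltrametricDist K] {x y : K} (hx : ‖x - 1‖ < 1) (hy : ‖y - 1‖ < 1) :
    ‖x * y - 1‖ < 1 := by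
  have h : x * y - 1 = (x - 1) * (y - 1) + ((x - 1) + (y - 1)) := by ring
  rw [h]
  refine (IsUltrametricDist.norm_add_le_max _ _).trans_lt (max_lt ?_
    ((IsUltrametricDist.norm_add_le_max _ _).trans_lt (max_lt hx hy)))
  rw [norm_mul]
  exact mul_lt_one_of_nonneg_of_lt_one_left (norm_nonneg _) hx hy.le

/-- The group of principal units of an ultrametric normed field. -/
def principalUnits (Cp : Type*) [NormedField Cp] [IsUltrametricDist Cp] : Subgroup Cpˣ where
  carrier := {x | ‖(x : Cp) - 1‖ < 1}
  one_mem' := by simp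
  mul_mem' := fun {x y} hx hy => by
    simpa using norm_mul_sub_one_lt hx hy
  inv_mem' := fun {x} hx => by
    have hx1 : ‖(x : Cp)‖ = 1 := by
      have h : ‖(x : Cp) - 1‖ < ‖(1 : Cp)‖ := by simpa using hx
      rw [← sub_add_cancel (x : Cp) 1, IsUltrametricDist.norm_add_eq_max_of_norm_ne_norm h.ne,
        max_eq_right h.le, norm_one]
    have h : ((x⁻¹ : Cpˣ) : Cp) - 1 = -(((x : Cp) - 1) * ((x⁻¹ : Cpˣ) : Cp)) := by
      rw [sub_mul, Units.mul_inv]; ring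
    change ‖((x⁻¹ : Cpˣ) : Cp) - 1‖ < 1
    rw [h, norm_neg, norm_mul, Units.val_inv_eq_inv_val, norm_inv, hx1, inv_one, mul_one]
    exact hx

theorem tsum_choose_sub_one {K : Type*} [NormedField K] [CharZero K] (z : K) {n : ℕ}
    (hn : n ≠ 0) :
    ∑' k : ℕ, (((n - 1).choose k : ℕ) : K) * z ^ (k + 1) / ((k : K) + 1) =
      ((1 + z) ^ n - 1) / (n : K) := by
  obtain ⟨N, rfl⟩ := Nat.exists_eq_succ_of_ne_zero hn
  rw [Nat.succ_eq_add_one, Nat.add_sub_cancel, tsum_eq_sum (s := Finset.range (N + 1))]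
  · have hN0 : ((N + 1 : ℕ) : K) ≠ 0 := by exact_mod_cast N.succ_ne_zero
    rw [eq_div_iff hN0, add_comm 1 z, add_pow, Finset.sum_range_succ' _ (N + 1), Finset.sum_mul]
    simp only [one_pow, mul_one, pow_zero, Nat.choose_zero_right, Nat.cast_one, add_sub_cancel_right]
    refine Finset.sum_congr rfl fun k _ => ?_
    have hk : (k : K) + 1 ≠ 0 := Nat.cast_add_one_ne_zero k
    have h1 : ((N + 1 : ℕ) : K) * (N.choose k : ℕ) =
        ((N + 1).choose (k + 1) : ℕ) * ((k : K) + 1) := by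
      exact_mod_cast Nat.add_one_mul_choose_eq N k
    field_simp
    linear_combination z ^ (k + 1) * h1
  · intro k hk
    rw [Nat.choose_eq_zero_of_lt (by simpa using hk)]
    simp

section PadicLog

variable {p : ℕ} [Fact p.Prime] {Cp : Type*} [NormedField Cp] [Algebra ℚ_[p] Cp]

theorem norm_natCast_eq_padic (hpadic : ∀ x : ℚ_[p], ‖algebraMap ℚ_[p] Cp x‖ = ‖x‖) (n : ℕ) :
    ‖(n : Cp)‖ = ‖(n : ℚ_[p])‖ := by
  rw [← hpadic, map_natCast]

theorem norm_natCast_le_one_of_padic (hpadic : ∀ x : ℚ_[p], ‖algebraMap ℚ_[p] Cp x‖ = ‖x‖)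
    (n : ℕ) : ‖(n : Cp)‖ ≤ 1 := by
  rw [norm_natCast_eq_padic hpadic]
  simpa using Padic.norm_int_le_one (p := p) n

theorem inv_norm_natCast_le (hpadic : ∀ x : ℚ_[p], ‖algebraMap ℚ_[p] Cp x‖ = ‖x‖)
    {n : ℕ} (hn : n ≠ 0) : ‖(n : Cp)‖⁻¹ ≤ n := by
  rw [norm_natCast_eq_padic hpadic, ← Rat.cast_natCast (α := ℚ_[p]) n, Padic.eq_padicNorm,
    padicNorm.eq_zpow_of_nonzero (by exact_mod_cast hn), padicValRat.of_nat]
  rw [Rat.cast_zpow, zpow_neg, inv_inv, zpow_natCast]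
  exact_mod_cast Nat.le_of_dvd (Nat.pos_of_ne_zero hn) pow_padicValNat_dvd

theorem norm_prime_lt_one (hpadic : ∀ x : ℚ_[p], ‖algebraMap ℚ_[p] Cp x‖ = ‖x‖) :
    ‖(p : Cp)‖ < 1 := by
  rw [norm_natCast_eq_padic hpadic]
  exact Padic.norm_p_lt_one

theorem tendsto_prime_pow_zero (hpadic : ∀ x : ℚ_[p], ‖algebraMap ℚ_[p] Cp x‖ = ‖x‖) :
    Tendsto (fun n : ℕ => ((p ^ n : ℕ) : Cp)) atTop (nhds 0) := by
  simpa using tendsto_pow_atTop_nhds_zero_of_norm_lt_one (norm_prime_lt_one hpadic)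

theorem summable_succ_mul_pow {q : ℝ} (hq0 : 0 ≤ q) (hq : q < 1) :
    Summable fun k : ℕ => ((k : ℝ) + 1) * q ^ (k + 1) := by
  have h := (summable_nat_add_iff 1).2
    (summable_pow_mul_geometric_of_norm_lt_one (R := ℝ) 1 (r := q) (by
      rwa [Real.norm_of_nonneg hq0]))
  simpa using h

theorem norm_pow_div_le (hpadic : ∀ x : ℚ_[p], ‖algebraMap ℚ_[p] Cp x‖ = ‖x‖)
    (c z : Cp) (hc : ‖c‖ ≤ 1) (k : ℕ) :
    ‖c * z ^ (k + 1) / ((k : Cp) + 1)‖ ≤ ((k : ℝ) + 1) * ‖z‖ ^ (k + 1) := by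
  have h := inv_norm_natCast_le (Cp := Cp) hpadic k.succ_ne_zero
  push_cast at h
  rw [norm_div, norm_mul, norm_pow, div_eq_mul_inv, mul_comm]
  gcongr
  exact mul_le_of_le_one_left (by positivity) hc

variable [CharZero Cp]

theorem tendsto_choose_prime_pow_sub_one
    (hpadic : ∀ x : ℚ_[p], ‖algebraMap ℚ_[p] Cp x‖ = ‖x‖) (k : ℕ) :
    Tendsto (fun n : ℕ => (((p ^ n - 1).choose k : ℕ) : Cp)) atTop (nhds ((-1) ^ k)) := by
  induction k with
  | zero => simp
  | succ k ih =>
    have key : ∀ n : ℕ, (((p ^ n - 1).choose (k + 1) : ℕ) : Cp) =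
        ((p ^ n : ℕ) : Cp) * ((p ^ n - 1).choose k : ℕ) / ((k : Cp) + 1)
          - ((p ^ n - 1).choose k : ℕ) := by
      intro n
      obtain ⟨N, hN⟩ : ∃ N, p ^ n = N + 1 :=
        Nat.exists_eq_succ_of_ne_zero (pow_ne_zero _ (Fact.out : p.Prime).ne_zero)
      have h1 := Nat.add_one_mul_choose_eq N k
      have h2 := Nat.choose_succ_succ N k
      rw [hN, Nat.add_sub_cancel]
      have hk : (k : Cp) + 1 ≠ 0 := Nat.cast_add_one_ne_zero k
      have h1' : ((N + 1 : ℕ) : Cp) * (N.choose k : ℕ) =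
          ((N.choose k : ℕ) + (N.choose (k + 1) : ℕ)) * ((k : Cp) + 1) := by
        exact_mod_cast h2 ▸ h1
      rw [h1']
      field_simp
      ring
    simp_rw [key]
    have h := (((tendsto_prime_pow_zero hpadic).mul ih).div_const ((k : Cp) + 1)).sub ih
    convert h using 2
    ring

variable [CompleteSpace Cp]

/-- The `p`-adic logarithm is the limit of `(x ^ (p ^ n) - 1) / p ^ n`. -/
theorem tendsto_plog (hpadic : ∀ x : ℚ_[p], ‖algebraMap ℚ_[p] Cp x‖ = ‖x‖)
    {x : Cp} (hx : ‖x - 1‖ < 1) :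
    Tendsto (fun n : ℕ => (x ^ p ^ n - 1) / ((p ^ n : ℕ) : Cp)) atTop (nhds (plog Cp x)) := by
  have h := tendsto_tsum_of_dominated_convergence (𝓕 := atTop)
    (f := fun (n k : ℕ) => (((p ^ n - 1).choose k : ℕ) : Cp) * (x - 1) ^ (k + 1) / ((k : Cp) + 1))
    (g := fun k : ℕ => (-1) ^ k * (x - 1) ^ (k + 1) / ((k : Cp) + 1))
    (summable_succ_mul_pow (norm_nonneg (x - 1)) hx)
    (fun k => ((tendsto_choose_prime_pow_sub_one hpadic k).mul_const _).div_const _)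
    (Eventually.of_forall fun n k =>
      norm_pow_div_le hpadic _ _ (norm_natCast_le_one_of_padic hpadic _) k)
  simp_rw [tsum_choose_sub_one _ (pow_ne_zero _ (Fact.out : p.Prime).ne_zero), add_sub_cancel] at h
  simpa [plog, pow_succ] using h

theorem tendsto_pow_prime_pow_one (hpadic : ∀ x : ℚ_[p], ‖algebraMap ℚ_[p] Cp x‖ = ‖x‖)
    {x : Cp} (hx : ‖x - 1‖ < 1) :
    Tendsto (fun n : ℕ => x ^ p ^ n) atTop (nhds 1) := by
  have h := (((tendsto_plog hpadic hx).mul (tendsto_prime_pow_zero hpadic)).add_const 1)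
  rw [mul_zero, zero_add] at h
  refine h.congr fun n => ?_
  have : ((p ^ n : ℕ) : Cp) ≠ 0 := by
    exact_mod_cast pow_ne_zero n (Fact.out : p.Prime).ne_zero
  rw [div_mul_cancel₀ _ this, sub_add_cancel]

variable [IsUltrametricDist Cp]

theorem plog_mul (hpadic : ∀ x : ℚ_[p], ‖algebraMap ℚ_[p] Cp x‖ = ‖x‖)
    {x y : Cp} (hx : ‖x - 1‖ < 1) (hy : ‖y - 1‖ < 1) :
    plog Cp (x * y) = plog Cp x + plog Cp y := by
  have h := ((tendsto_plog hpadic hx).mul (tendsto_pow_prime_pow_one hpadic hy)).add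
    (tendsto_plog hpadic hy)
  rw [mul_one] at h
  refine tendsto_nhds_unique (tendsto_plog hpadic (norm_mul_sub_one_lt hx hy)) (h.congr fun n => ?_)
  rw [mul_pow]
  ring

theorem eq_one_of_plog_eq_zero (hpadic : ∀ x : ℚ_[p], ‖algebraMap ℚ_[p] Cp x‖ = ‖x‖)
    {x : Cp} (hx : ‖x - 1‖ ≤ 1 / 4) (h : plog Cp x = 0) : x = 1 := by
  by_contra hne
  have hz : 0 < ‖x - 1‖ := norm_pos_iff.2 (sub_ne_zero.2 hne)
  have hx1 : ‖x - 1‖ < 1 := by linarith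
  have hs : Summable fun k : ℕ => (-1) ^ (k + 1 + 1) * (x - 1) ^ (k + 1) / ((k : Cp) + 1) :=
    Summable.of_norm_bounded (summable_succ_mul_pow (norm_nonneg _) hx1)
      fun k => norm_pow_div_le hpadic ((-1) ^ (k + 1 + 1)) _ (by simp) k
  rw [plog, hs.tsum_eq_zero_add] at h
  have hx2 : x - 1 = -∑' k : ℕ, (-1) ^ (k + 1 + 1 + 1) * (x - 1) ^ (k + 1 + 1) /
      (((k + 1 : ℕ) : Cp) + 1) := by
    rw [eq_neg_iff_add_eq_zero, ← h]
    simp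
  have hb : ‖x - 1‖ ≤ 1 / 2 * ‖x - 1‖ := by
    conv_lhs => rw [hx2, norm_neg]
    refine IsUltrametricDist.norm_tsum_le_of_forall_le_of_nonneg (by positivity) fun k => ?_
    refine (norm_pow_div_le hpadic ((-1) ^ (k + 1 + 1 + 1)) _ (by simp) (k + 1)).trans ?_
    rw [pow_succ, ← mul_assoc]
    gcongr
    have : ∀ k : ℕ, (((k + 1 : ℕ) : ℝ) + 1) * (1 / 4) ^ (k + 1) ≤ 1 / 2 := by
      intro k
      induction k with
      | zero => norm_num
      | succ k ih =>
        rw [pow_succ]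
        have : (0 : ℝ) < (1 / 4) ^ (k + 1) := by positivity
        push_cast at ih ⊢
        nlinarith
    refine le_trans ?_ (this k)
    gcongr
  linarith

/-- The `p`-adic logarithm as a homomorphism on principal units. -/
noncomputable def plogHom (hpadic : ∀ x : ℚ_[p], ‖algebraMap ℚ_[p] Cp x‖ = ‖x‖) :
    principalUnits Cp →* Multiplicative Cp :=
  MonoidHom.mk' (fun x => Multiplicative.ofAdd (plog Cp (x : Cpˣ)))
    fun x y => congrArg Multiplicative.ofAdd (plog_mul hpadic x.2 y.2)

theorem exists_pow_eq_one_of_plogHom_eq_one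
    (hpadic : ∀ x : ℚ_[p], ‖algebraMap ℚ_[p] Cp x‖ = ‖x‖) {x : principalUnits Cp}
    (h : plogHom hpadic x = 1) : ∃ N : ℕ, N ≠ 0 ∧ x ^ N = 1 := by
  have ht := tendsto_pow_prime_pow_one hpadic x.2
  obtain ⟨n, hn⟩ := (ht.eventually (Metric.closedBall_mem_nhds (1 : Cp)
    (by norm_num : (0 : ℝ) < 1 / 4))).exists
  rw [dist_eq_norm] at hn
  refine ⟨p ^ n, pow_ne_zero _ (Fact.out : p.Prime).ne_zero, Subtype.ext (Units.ext ?_)⟩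
  refine eq_one_of_plog_eq_zero hpadic (by simpa using hn) ?_
  have : plogHom hpadic (x ^ p ^ n) = 1 := by rw [map_pow, h, one_pow]
  exact this

/-- A multiplicative version of injectivity of the `p`-adic logarithm modulo torsion. -/
theorem exists_prod_zpow_eq_one_of_sum_plog_eq_zero
    (hpadic : ∀ x : ℚ_[p], ‖algebraMap ℚ_[p] Cp x‖ = ‖x‖) {M ι : Type*} [Field M] [Fintype ι]
    (σ : M →+* Cp) (u : ι → Mˣ) (hu : ∀ i, ‖σ (u i) - 1‖ < 1) (n : ι → ℤ)
    (h : ∑ i, (n i : Cp) * plog Cp (σ (u i)) = 0) :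
    ∃ N : ℕ, N ≠ 0 ∧ (∏ i, u i ^ n i) ^ N = 1 := by
  let y : ι → principalUnits Cp := fun i => ⟨Units.map (σ : M →* Cp) (u i), hu i⟩
  obtain ⟨N, hN, hN1⟩ := exists_pow_eq_one_of_plogHom_eq_one hpadic
    (x := ∏ i, y i ^ n i) (by
      rw [map_prod]
      simp_rw [map_zpow]
      apply Multiplicative.toAdd.injective
      rw [toAdd_prod, toAdd_one, ← h]
      refine Finset.sum_congr rfl fun i _ => ?_
      rw [toAdd_zpow, zsmul_eq_mul]
      rfl)
  refine ⟨N, hN, Units.map_injective (f := (σ : M →* Cp)) σ.injective ?_⟩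
  have h2 := congrArg (principalUnits Cp).subtype hN1
  simp only [map_pow, map_prod, map_zpow, map_one] at h2 ⊢
  exact h2

end PadicLog

theorem ker_linearCombination_le_of_int_relations {ι V W : Type*} [Fintype ι] [AddCommGroup V]
    [Module ℚ V] [AddCommGroup W] [Module ℚ W] {x : ι → V} {w : ι → W}
    (hrel : ∀ n : ι → ℤ, ∑ i, n i • x i = 0 → ∑ i, n i • w i = 0) :
    (Fintype.linearCombination ℚ x).ker ≤ (Fintype.linearCombination ℚ w).ker := by
  intro q hq
  obtain ⟨b, hb⟩ := IsLocalization.exist_integer_multiples_of_finite (nonZeroDivisors ℤ) q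
  choose n hn using hb
  have hn' : ((b : ℤ) : ℚ) • q = fun i => (n i : ℚ) := funext fun i => by simpa using (hn i).symm
  have hb0 : ((b : ℤ) : ℚ) ≠ 0 := by exact_mod_cast nonZeroDivisors.coe_ne_zero b
  have h := hrel n
  simp_rw [← Int.cast_smul_eq_zsmul ℚ] at h
  rw [← Submodule.smul_mem_iff _ hb0, hn', LinearMap.mem_ker,
    Fintype.linearCombination_apply] at hq ⊢
  exact h hq

/-- If every linearly independent subfamily of `x` is algebraically independent, then `w` satisfies
all polynomial relations of `x` as soon as it satisfies all its linear relations. -/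
theorem aeval_eq_zero_of_linear_relations {ι K L : Type*} [Fintype ι] [Field K] [Algebra ℚ K]
    [CommRing L] [Algebra ℚ L] {x : ι → K} {w : ι → L}
    (hrel : ∀ n : ι → ℤ, ∑ i, n i • x i = 0 → ∑ i, n i • w i = 0)
    (hind : ∀ (m : ℕ) (f : Fin m → ι), LinearIndependent ℚ (x ∘ f) →
      AlgebraicIndependent ℚ (x ∘ f))
    (Q : MvPolynomial ι ℚ) (hQ : MvPolynomial.aeval x Q = 0) : MvPolynomial.aeval w Q = 0 := by
  classical
  obtain ⟨κ, a, ha, hspan, hli⟩ := exists_linearIndependent' ℚ x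
  have : Finite κ := Finite.of_injective a ha
  have := Fintype.ofFinite κ
  have halg : AlgebraicIndependent ℚ (x ∘ a) := by
    let e := Fintype.equivFin κ
    have h := hind _ (a ∘ e.symm) (hli.comp e.symm e.symm.injective)
    have h2 := h.comp e e.injective
    convert h2 using 1
    ext i
    simp
  have hb : ∀ i, ∃ b : κ → ℚ, ∑ j, b j • x (a j) = x i := fun i => by
    have h : x i ∈ Submodule.span ℚ (Set.range (x ∘ a)) :=
      hspan ▸ Submodule.subset_span ⟨i, rfl⟩
    exact (Submodule.mem_span_range_iff_exists_fun ℚ).1 h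
  choose b hb using hb
  have hw : ∀ i, ∑ j, b i j • w (a j) = w i := fun i => by
    have hv : ∑ j, b i j • Pi.single (a j) (1 : ℚ) - Pi.single i 1 ∈
        (Fintype.linearCombination ℚ x).ker := by
      simp [map_sub, map_sum, Fintype.linearCombination_apply_single, hb]
    have h := ker_linearCombination_le_of_int_relations hrel hv
    simpa [map_sub, map_sum, Fintype.linearCombination_apply_single, sub_eq_zero] using h
  let ψ : MvPolynomial ι ℚ →ₐ[ℚ] MvPolynomial κ ℚ :=
    MvPolynomial.aeval fun i => ∑ j, b i j • MvPolynomial.X j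
  have hx' : (MvPolynomial.aeval (x ∘ a)).comp ψ = MvPolynomial.aeval x :=
    MvPolynomial.algHom_ext fun i => by simp [ψ, hb]
  have hw' : (MvPolynomial.aeval (w ∘ a)).comp ψ = MvPolynomial.aeval w :=
    MvPolynomial.algHom_ext fun i => by simp [ψ, hw]
  rw [← hx', AlgHom.comp_apply] at hQ
  rw [← hw', AlgHom.comp_apply, halg.eq_zero_of_aeval_eq_zero _ hQ, map_zero]

/-- The matrix with entries `y (e t j)`. -/
def entryMatrix {ι T m L : Type*} (e : T → m → ι) (y : ι → L) : Matrix T m L :=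
  Matrix.of fun t j => y (e t j)

theorem aeval_det_entryMatrix {ι T m L : Type*} [Fintype T] [DecidableEq T] [Fintype m]
    [CommRing L] [Algebra ℚ L] (e : T → m → ι) (y : ι → L) :
    MvPolynomial.aeval y
      (entryMatrix e (MvPolynomial.X (R := ℚ)) *
        (entryMatrix e (MvPolynomial.X (R := ℚ))).transpose).det =
      (entryMatrix e y * (entryMatrix e y).transpose).det := by
  rw [AlgHom.map_det]
  congr 1
  ext s t
  simp [entryMatrix, Matrix.mul_apply]

theorem det_mul_transpose_ne_zero {T m : Type*} [Fintype T] [DecidableEq T] [Fintype m]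
    {A : Matrix T m ℝ} (hA : LinearIndependent ℝ A.row) : (A * A.transpose).det ≠ 0 := by
  have hrank := hA.rank_matrix
  rw [← Matrix.rank_self_mul_transpose, Matrix.rank_eq_finrank_span_row] at hrank
  exact ((Matrix.isUnit_iff_isUnit_det _).1 (Matrix.linearIndependent_rows_iff_isUnit.1
    (linearIndependent_iff_card_eq_finrank_span.2 hrank.symm))).ne_zero

/-- The rank of a matrix of values of `x` is bounded below by the rank of the corresponding
matrix of a specialization `w`, provided its rows are independent. -/
theorem card_le_rank_of_specialization {ι T m K : Type*} [Fintype T] [Fintype m] [Field K]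
    [Algebra ℚ K] {x : ι → K} {w : ι → ℝ} (e : T → m → ι)
    (hspec : ∀ Q : MvPolynomial ι ℚ, MvPolynomial.aeval x Q = 0 → MvPolynomial.aeval w Q = 0)
    (hw : LinearIndependent ℝ (entryMatrix e w).row) :
    Fintype.card T ≤ (entryMatrix e x).rank := by
  classical
  have hne := mt (hspec _) ((aeval_det_entryMatrix e w).trans_ne (det_mul_transpose_ne_zero hw))
  rw [aeval_det_entryMatrix] at hne
  rw [← Matrix.rank_of_isUnit _ ((Matrix.isUnit_iff_isUnit_det _).2 (isUnit_iff_ne_zero.2 hne))]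
  exact Matrix.rank_mul_le_left _ _

/-- The logarithmic absolute values of a family of elements satisfy the relations coming from
multiplicative relations up to torsion. -/
theorem sum_log_norm_eq_zero_of_prod_zpow {M ι : Type*} [Field M] [Fintype ι]
    (τ : M →+* ℂ) (u : ι → Mˣ) (n : ι → ℤ) {N : ℕ} (hN : N ≠ 0) (h : (∏ i, u i ^ n i) ^ N = 1) :
    ∑ i, n i • Real.log ‖τ (u i)‖ = 0 := by
  have h1 := congrArg (fun x : Mˣ => Real.log ‖τ x‖) h
  have h2 : (N : ℝ) * ∑ i, n i • Real.log ‖τ (u i)‖ = 0 := by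
    rw [← Real.log_one, ← norm_one (α := ℂ), ← map_one τ]
    refine Eq.trans ?_ h1
    simp only [Units.val_pow_eq_pow_val, Units.coe_prod, Units.val_zpow_eq_zpow_val, map_pow,
      map_prod, map_zpow₀, norm_pow, norm_prod, norm_zpow, Real.log_pow]
    rw [Real.log_prod fun i _ => zpow_ne_zero _ (by simp)]
    simp
  exact (mul_eq_zero.1 h2).resolve_left (by exact_mod_cast hN)

section Archimedean

open NumberField

variable {M : Type*} [Field M] [NumberField M]

/-- A linear form in the logarithms of the absolute values of the units which vanishes on all units
is proportional to the product formula. -/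
theorem eq_zero_of_sum_log_units_eq_zero {c : InfinitePlace M → ℝ}
    (h : ∀ u : (𝓞 M)ˣ, ∑ v, c v * Real.log (v (u : M)) = 0) {v₀ : InfinitePlace M}
    (hv₀ : c v₀ = 0) : c = 0 := by
  classical
  let w₀ : InfinitePlace M := Units.dirichletUnitTheorem.w₀
  let lam : ℝ := c w₀ / w₀.mult
  have hm : ∀ v : InfinitePlace M, (v.mult : ℝ) ≠ 0 := fun v => InfinitePlace.mult_coe_ne_zero
  let φ : Units.dirichletUnitTheorem.logSpace M →ₗ[ℝ] ℝ :=
    Fintype.linearCombination ℝ fun v => c v / (v : InfinitePlace M).mult - lam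
  have hφ : φ = 0 := by
    refine LinearMap.ext_on (Units.dirichletUnitTheorem.unitLattice_span_eq_top M) ?_
    rintro _ ⟨u, -, rfl⟩
    have h1 := h u.toMul
    have h2 := Units.sum_mult_mul_log u.toMul
    have h3 : ∑ v : InfinitePlace M, (c v / v.mult - lam) *
        (v.mult * Real.log (v (u.toMul : M))) = 0 := by
      calc _ = ∑ v : InfinitePlace M, c v * Real.log (v (u.toMul : M)) -
            lam * ∑ v : InfinitePlace M, v.mult * Real.log (v (u.toMul : M)) := by
            rw [Finset.mul_sum, ← Finset.sum_sub_distrib]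
            refine Finset.sum_congr rfl fun v _ => ?_
            rw [sub_mul, ← mul_assoc, div_mul_cancel₀ _ (hm v)]
        _ = 0 := by rw [h1, h2]; simp
    rw [Fintype.sum_eq_add_sum_subtype_ne _ w₀, sub_self, zero_mul, zero_add] at h3
    rw [LinearMap.zero_apply, ← h3, Fintype.linearCombination_apply]
    exact Finset.sum_congr rfl fun v _ => mul_comm _ _
  have hc : ∀ v, c v = lam * v.mult := by
    intro v
    by_cases hv : v = w₀
    · rw [hv, div_mul_cancel₀ _ (hm w₀)]
    · have h4 := LinearMap.congr_fun hφ (Pi.single ⟨v, hv⟩ 1)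
      rw [Fintype.linearCombination_apply_single, LinearMap.zero_apply, one_smul,
        sub_eq_zero] at h4
      rw [← h4, div_mul_cancel₀ _ (hm v)]
  have hlam : lam = 0 := by
    simpa [hv₀, hm v₀] using (hc v₀).symm
  ext v
  rw [hc, hlam, zero_mul, Pi.zero_apply]

theorem sum_log_units_eq_zero_of_closure {ι : Type*} {u : ι → (𝓞 M)ˣ}
    (hu : (Subgroup.closure (Set.range u)).FiniteIndex) {c : InfinitePlace M → ℝ}
    (h : ∀ i, ∑ v, c v * Real.log (v (u i : M)) = 0) (x : (𝓞 M)ˣ) :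
    ∑ v, c v * Real.log (v (x : M)) = 0 := by
  let f : (𝓞 M)ˣ →* Multiplicative ℝ := MonoidHom.mk'
    (fun x => Multiplicative.ofAdd (∑ v : InfinitePlace M, c v * Real.log (v (x : M))))
    fun x y => by
      rw [← ofAdd_add, ← Finset.sum_add_distrib]
      congr 1
      refine Finset.sum_congr rfl fun v _ => ?_
      rw [Units.coe_mul, map_mul, Real.log_mul (Units.pos_at_place _ _).ne'
        (Units.pos_at_place _ _).ne', mul_add]
  have hle : Subgroup.closure (Set.range u) ≤ f.ker := by
    rw [Subgroup.closure_le]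
    rintro _ ⟨i, rfl⟩
    exact congrArg Multiplicative.ofAdd (h i)
  obtain ⟨n, hn, -, hx⟩ := Subgroup.exists_pow_mem_of_index_ne_zero hu.index_ne_zero x
  have h2 : f x ^ n = 1 := by
    rw [← map_pow]
    exact hle hx
  have h3 : n • (∑ v : InfinitePlace M, c v * Real.log (v (x : M))) = 0 := h2
  exact (smul_eq_zero.1 h3).resolve_left hn.ne'

theorem exists_inducedByConj [IsGalois ℚ M] : ∃ c : M ≃ₐ[ℚ] M, InducedByConj M c := by
  obtain ⟨τ⟩ : Nonempty (M →+* ℂ) := inferInstance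
  obtain ⟨c, hc⟩ := ComplexEmbedding.exists_comp_symm_eq_of_comp_eq (k := ℚ) τ
    (ComplexEmbedding.conjugate τ) (Subsingleton.elim _ _)
  exact ⟨c.symm, τ, fun x => RingHom.congr_fun hc x⟩

theorem exists_place_comp_eq [IsGalois ℚ M] (τ : M →+* ℂ) (v : InfinitePlace M) :
    ∃ h : M ≃ₐ[ℚ] M, InfinitePlace.mk (τ.comp (h : M →+* M)) = v := by
  obtain ⟨h, hh⟩ := ComplexEmbedding.exists_comp_symm_eq_of_comp_eq (k := ℚ) τ v.embedding
    (Subsingleton.elim _ _)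
  refine ⟨h.symm, ?_⟩
  rw [← InfinitePlace.mk_embedding v, ← hh]

theorem mk_comp_eq_iff {τ : M →+* ℂ} {c : M ≃ₐ[ℚ] M}
    (hc : ∀ x, τ (c x) = (starRingEnd ℂ) (τ x)) (g h : M ≃ₐ[ℚ] M) :
    InfinitePlace.mk (τ.comp (g : M →+* M)) = InfinitePlace.mk (τ.comp (h : M →+* M)) ↔
      g = h ∨ g = c * h := by
  have hinj : ∀ a b : M ≃ₐ[ℚ] M, (∀ x, τ (a x) = τ (b x)) → a = b := fun a b hab =>
    AlgEquiv.ext fun x => τ.injective (hab x)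
  rw [eq_comm, InfinitePlace.mk_eq_iff]
  refine or_congr ⟨fun H => ?_, ?_⟩ ⟨fun H => ?_, ?_⟩
  · exact (hinj _ _ fun x => RingHom.congr_fun H x).symm
  · rintro rfl
    rfl
  · refine hinj _ _ fun x => ?_
    rw [AlgEquiv.mul_apply, hc]
    exact (RingHom.congr_fun H x).symm
  · rintro rfl
    ext x
    exact (hc (h x)).symm

/-- The cosets of `{1, c}` contained in `J` correspond to the infinite places all of whose
representatives lie in `J`. -/
theorem tcos_eq_card_places [IsGalois ℚ M] {τ : M →+* ℂ} {c : M ≃ₐ[ℚ] M}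
    (hc : ∀ x, τ (c x) = (starRingEnd ℂ) (τ x)) (J : Set (M ≃ₐ[ℚ] M)) :
    tcos c J = Set.ncard {v : InfinitePlace M |
      ∀ h : M ≃ₐ[ℚ] M, InfinitePlace.mk (τ.comp (h : M →+* M)) = v → h ∈ J} := by
  let F : InfinitePlace M → Set (M ≃ₐ[ℚ] M) := fun v =>
    {h | InfinitePlace.mk (τ.comp (h : M →+* M)) = v}
  have hF : Function.Injective F := by
    intro v v' hvv
    obtain ⟨h, rfl⟩ := exists_place_comp_eq τ v
    have : h ∈ F v' := hvv ▸ rfl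
    exact this
  have hFmk : ∀ g : M ≃ₐ[ℚ] M, F (InfinitePlace.mk (τ.comp (g : M →+* M))) = {g, c * g} :=
    fun g => Set.ext fun h => mk_comp_eq_iff hc h g
  rw [tcos, ← Set.ncard_image_of_injective _ hF]
  congr 1
  ext s
  constructor
  · rintro ⟨⟨g, rfl⟩, hs⟩
    exact ⟨_, fun h hh => hs (hFmk g ▸ hh), hFmk g⟩
  · rintro ⟨v, hv, rfl⟩
    obtain ⟨g, rfl⟩ := exists_place_comp_eq τ v
    exact ⟨⟨g, hFmk g⟩, fun h hh => hv h hh⟩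

/-- Independence of the archimedean logarithm vectors of the conjugates of a weak Minkowski unit at
any set of infinite places missing some place. -/
theorem linearIndependent_log_conjugates {ε : (𝓞 M)ˣ} (hε : IsWeakMinkowskiUnit M ε)
    (τ : M →+* ℂ) {T : Type*} [Fintype T] (v : T → InfinitePlace M) (hv : Function.Injective v)
    {v₀ : InfinitePlace M} (hv₀ : v₀ ∉ Set.range v) (h : T → (M ≃ₐ[ℚ] M))
    (hh : ∀ t, InfinitePlace.mk (τ.comp (h t : M →+* M)) = v t) :
    LinearIndependent ℝ (entryMatrix (fun t g => h t * g)
      fun g : M ≃ₐ[ℚ] M => Real.log ‖τ (g (ε : M))‖).row := by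
  classical
  obtain ⟨u, hu, hfin⟩ := hε
  rw [Fintype.linearIndependent_iff]
  intro a ha t
  let c : InfinitePlace M → ℝ := Function.extend v a 0
  have hcv : ∀ t, c (v t) = a t := hv.extend_apply a 0
  have hc0 : ∀ w, w ∉ Set.range v → c w = 0 := fun w hw => Function.extend_apply' _ _ _ hw
  have hsum : ∀ y : InfinitePlace M → ℝ, ∑ w, c w * y w = ∑ t, a t * y (v t) := by
    intro y
    rw [← Finset.sum_subset (Finset.subset_univ (Finset.univ.image v)) fun w _ hw => by
      rw [hc0 w (by simpa using hw), zero_mul], Finset.sum_image hv.injOn]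
    simp_rw [hcv]
  have h0 : c = 0 := by
    refine eq_zero_of_sum_log_units_eq_zero (sum_log_units_eq_zero_of_closure hfin fun g => ?_)
      (v₀ := v₀) (hc0 v₀ hv₀)
    rw [hsum]
    refine Eq.trans ?_ (congrFun ha g)
    rw [Finset.sum_apply]
    refine Finset.sum_congr rfl fun t _ => ?_
    rw [← hh, InfinitePlace.apply, hu]
    rfl
  rw [← hcv t]
  exact congrFun h0 (v t)

end Archimedean

theorem exists_places_missing {X : Type*} [Fintype X] [Nonempty X] (B : Set X) :
    ∃ (T : Set X) (v₀ : X), v₀ ∉ T ∧ T ⊆ Bᶜ ∧ Fintype.card X - 1 ≤ T.ncard + (B.ncard - 1) := by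
  have hcompl := Set.ncard_add_ncard_compl B
  rw [Nat.card_eq_fintype_card] at hcompl
  rcases B.eq_empty_or_nonempty with rfl | ⟨v₀, hv₀⟩
  · obtain ⟨v₀⟩ := ‹Nonempty X›
    have h := Set.ncard_add_ncard_compl {v₀}
    rw [Nat.card_eq_fintype_card, Set.ncard_singleton] at h
    exact ⟨{v₀}ᶜ, v₀, by simp, by simp, by omega⟩
  · have := (Set.ncard_pos).2 ⟨v₀, hv₀⟩
    exact ⟨Bᶜ, v₀, fun h => h hv₀, subset_rfl, by omega⟩

/-- Suppose `M` is a complex (not totally real) Galois extension of `ℚ`,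
and let `t = min_{c ∈ C} t_c`. Assuming the `p`-adic Schanuel conjecture, the rank of the
`p`-adic log matrix over `S_p × G` is at least `r − (t−1)⁺`. -/
theorem stmt6 (p : ℕ) [Fact p.Prime]
    (Cp : Type*) [NormedField Cp] [CompleteSpace Cp] [IsAlgClosed Cp] [CharZero Cp]
    [Algebra ℚ_[p] Cp] (hpadic : ∀ x : ℚ_[p], ‖algebraMap ℚ_[p] Cp x‖ = ‖x‖)
    (hiso : Nonempty (Cp ≃+* ℂ))
    (M : Type*) [Field M] [NumberField M] [IsGalois ℚ M]
    (hcx : ∃ (τ : M →+* ℂ) (x : M), (τ x).im ≠ 0)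
    (Sp : Set (M →+* Cp))
    (ε : (𝓞 M)ˣ) (hWM : IsWeakMinkowskiUnit M ε)
    (hloc : ∀ (σ : M →+* Cp) (g : M ≃ₐ[ℚ] M), ‖σ (g (algebraMap (𝓞 M) M ε)) - 1‖ < 1)
    (hSch : PadicSchanuel Cp) :
    ∀ σ : M →+* Cp,
      ((padicLogMatrix Cp M Sp (algebraMap (𝓞 M) M ε)).rank : ℤ) ≥
        (NumberField.Units.rank M : ℤ) -
          max (((sInf {k : ℕ | ∃ c : M ≃ₐ[ℚ] M, InducedByConj M c ∧
            k = tcos c (Jset Cp M Sp σ)} : ℕ) : ℤ) - 1) 0 := by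
  intro σ
  have : IsUltrametricDist Cp := IsUltrametricDist.isUltrametricDist_of_forall_norm_natCast_le_one
    (norm_natCast_le_one_of_padic hpadic)
  obtain ⟨c₀, hc₀⟩ := exists_inducedByConj (M := M)
  obtain ⟨c, ⟨τ, hτ⟩, hc⟩ := Nat.sInf_mem (s := {k : ℕ | ∃ c : M ≃ₐ[ℚ] M, InducedByConj M c ∧
    k = tcos c (Jset Cp M Sp σ)}) ⟨_, c₀, hc₀, rfl⟩
  rw [hc, tcos_eq_card_places hτ]
  obtain ⟨T, v₀, hv₀, hTB, hcard⟩ := exists_places_missing {v : NumberField.InfinitePlace M |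
    ∀ h : M ≃ₐ[ℚ] M, NumberField.InfinitePlace.mk (τ.comp (h : M →+* M)) = v →
      h ∈ Jset Cp M Sp σ}
  have hT : ∀ t : T, ∃ h : M ≃ₐ[ℚ] M,
      NumberField.InfinitePlace.mk (τ.comp (h : M →+* M)) = t ∧ σ.comp (h : M →+* M) ∈ Sp := by
    intro t
    simpa [Jset] using hTB t.2
  choose h hh hS using hT
  have := Fintype.ofFinite T
  let u : (M ≃ₐ[ℚ] M) → Mˣ := fun g =>
    Units.map (g : M →* M) (Units.map (algebraMap (𝓞 M) M : 𝓞 M →* M) ε)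
  have hind := linearIndependent_log_conjugates hWM τ (Subtype.val : T → _)
    Subtype.val_injective (by simpa using hv₀) h hh
  have hrank := card_le_rank_of_specialization
    (x := fun g : M ≃ₐ[ℚ] M => plog Cp (σ (g (algebraMap (𝓞 M) M ε)))) (fun t g => h t * g)
    (aeval_eq_zero_of_linear_relations (fun n hn => ?_) fun m f hf => ?_) hind
  · have hle := Matrix.rank_submatrix_le
      (padicLogMatrix Cp M Sp (algebraMap (𝓞 M) M ε)) (fun t => ⟨_, hS t⟩) id
    have hrank' := hrank.trans hle
    rw [← Nat.card_eq_fintype_card, Nat.card_coe_set_eq] at hrank'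
    rw [NumberField.Units.rank]
    omega
  · obtain ⟨N, hN, hprod⟩ := exists_prod_zpow_eq_one_of_sum_plog_eq_zero hpadic σ u
      (hloc σ) n (by simpa [zsmul_eq_mul, u] using hn)
    exact sum_log_norm_eq_zero_of_prod_zpow τ u n hN hprod
  · refine hSch m _ (fun i => ?_) (fun i => hloc σ (f i)) hf
    exact (Algebra.IsAlgebraic.isAlgebraic (R := ℚ) (f i (algebraMap (𝓞 M) M ε))).algHom
      σ.toRatAlgHom
end

section
/- Suppose M is a complex (not totally real) Galois extension of ℚ. Then the quantity t := min_{c∈C} t_c does not depend on the choice of σ ∈ E_p used to define J_σ, and v = t. -/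
open scoped NumberField
open Filter

/-- `S_ψ = {ψ ∘ σ : σ ∈ S_p} ⊆ E`. -/
def Spsi (Cp : Type*) [Field Cp] (M : Type*) [Field M] (ψ : Cp ≃+* ℂ)
    (Sp : Set (M →+* Cp)) : Set (M →+* ℂ) :=
  (fun σ : M →+* Cp => ((ψ : Cp →+* ℂ).comp σ)) '' Sp

/-- The number of pairs of complex conjugate embeddings `{τ, τ̄}` contained in `E ∖ S`. -/
noncomputable def numConjPairs (M : Type*) [Field M] (S : Set (M →+* ℂ)) : ℕ :=
  Set.ncard {s : Set (M →+* ℂ) |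
    (∃ τ : M →+* ℂ, s = {τ, (starRingEnd ℂ).comp τ}) ∧ s ⊆ Sᶜ}

/-- Two algebraically closed extensions of a ring are isomorphic over it as soon as they have
equipotent transcendence bases. -/
theorem IsTranscendenceBasis.nonempty_algEquiv {R K L ι κ : Type*} [CommRing R]
    [Field K] [Algebra R K] [IsAlgClosed K] [Field L] [Algebra R L] [IsAlgClosed L]
    {v : ι → K} {w : κ → L} (e : ι ≃ κ)
    (hv : IsTranscendenceBasis R v) (hw : IsTranscendenceBasis R w) : Nonempty (K ≃ₐ[R] L) := by
  let := IsAlgClosed.isAlgClosure_of_transcendence_basis v hv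
  let := IsAlgClosed.isAlgClosure_of_transcendence_basis w hw
  let φ : Algebra.adjoin R (Set.range v) ≃ₐ[R] Algebra.adjoin R (Set.range w) :=
    (hv.1.aevalEquiv.symm.trans (MvPolynomial.renameEquiv R e)).trans hw.1.aevalEquiv
  refine ⟨AlgEquiv.ofRingEquiv (f := IsAlgClosure.equivOfEquiv K L φ.toRingEquiv) fun r => ?_⟩
  rw [IsScalarTower.algebraMap_apply R (Algebra.adjoin R (Set.range v)) K,
    IsAlgClosure.equivOfEquiv_algebraMap,
    IsScalarTower.algebraMap_apply R (Algebra.adjoin R (Set.range w)) L]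
  exact congrArg _ (φ.commutes r)

open Cardinal in
/-- Two equipotent uncountable algebraically closed extensions of a countable domain are
isomorphic over it. -/
theorem IsAlgClosed.nonempty_algEquiv_of_equiv {R K L : Type*} [CommRing R] [IsDomain R]
    [Countable R] [Field K] [Algebra R K] [IsAlgClosed K] [Field L] [Algebra R L] [IsAlgClosed L]
    [FaithfulSMul R K] [FaithfulSMul R L] [Uncountable K] (e : K ≃ L) :
    Nonempty (K ≃ₐ[R] L) := by
  have : Uncountable L := e.injective.uncountable
  obtain ⟨s, hs⟩ := exists_isTranscendenceBasis R K
  obtain ⟨t, ht⟩ := exists_isTranscendenceBasis R L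
  have hs' := cardinal_eq_cardinal_transcendence_basis_of_aleph0_lt _ hs mk_le_aleph0
    (aleph0_lt_mk_iff.2 ‹_›)
  have ht' := cardinal_eq_cardinal_transcendence_basis_of_aleph0_lt _ ht mk_le_aleph0
    (aleph0_lt_mk_iff.2 ‹_›)
  obtain ⟨f⟩ := Cardinal.lift_mk_eq'.1 <|
    (congrArg _ (lift_injective hs').symm).trans <|
      (Cardinal.lift_mk_eq'.2 ⟨e⟩).trans (congrArg _ (lift_injective ht'))
  exact hs.nonempty_algEquiv f ht

/-- An embedding of a number field into an algebraically closed field `K` equipotent to `ℂ` is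
carried to any given complex embedding by a field isomorphism from `K` to `ℂ`. -/
theorem exists_ringEquiv_comp_eq {K M : Type*} [Field K] [IsAlgClosed K] [Field M] [NumberField M]
    (e : K ≃ ℂ) (σ : M →+* K) (τ : M →+* ℂ) :
    ∃ ψ : K ≃+* ℂ, (ψ : K →+* ℂ).comp σ = τ := by
  let := σ.toAlgebra
  let := τ.toAlgebra
  have : Countable M := Cardinal.mk_le_aleph0_iff.1 <| by
    simpa using Algebra.IsAlgebraic.lift_cardinalMk_le_max ℚ M
  have : Uncountable ℂ := not_countable_iff.1 fun _ =>
    not_countable_complex Set.countable_univ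
  have : Uncountable K := e.symm.injective.uncountable
  obtain ⟨ψ⟩ := IsAlgClosed.nonempty_algEquiv_of_equiv (R := M) e
  exact ⟨ψ.toRingEquiv, RingHom.ext ψ.commutes⟩

section Translate

variable {M : Type*} [Field M] [NumberField M]

theorem comp_algEquiv_injective {K : Type*} [Field K] (τ : M →+* K) :
    Function.Injective fun g : M ≃ₐ[ℚ] M => τ.comp (g : M →+* M) := fun _ _ h =>
  AlgEquiv.ext fun x => τ.injective (RingHom.congr_fun h x)

variable [IsGalois ℚ M]

theorem comp_algEquiv_surjective (τ : M →+* ℂ) :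
    Function.Surjective fun g : M ≃ₐ[ℚ] M => τ.comp (g : M →+* M) := fun τ' =>
  let ⟨g, hg⟩ := NumberField.ComplexEmbedding.exists_comp_symm_eq_of_comp_eq (k := ℚ) τ τ'
    (Subsingleton.elim _ _)
  ⟨g.symm, hg⟩

theorem exists_comp_eq_conj (τ : M →+* ℂ) :
    ∃ c : M ≃ₐ[ℚ] M, ∀ x, τ (c x) = (starRingEnd ℂ) (τ x) :=
  let ⟨c, hc⟩ := comp_algEquiv_surjective τ ((starRingEnd ℂ).comp τ)
  ⟨c, RingHom.congr_fun hc⟩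

/-- Translating by `τ` identifies the cosets of `{1, c}` with the pairs of complex conjugate
embeddings, when `c` is complex conjugation seen through `τ`. -/
theorem numConjPairs_eq_tcos (τ : M →+* ℂ) (c : M ≃ₐ[ℚ] M)
    (hc : ∀ x, τ (c x) = (starRingEnd ℂ) (τ x)) (S : Set (M →+* ℂ)) :
    numConjPairs M S = tcos c {g | τ.comp (g : M →+* M) ∉ S} := by
  have key (g : M ≃ₐ[ℚ] M) : (starRingEnd ℂ).comp (τ.comp (g : M →+* M)) =
      τ.comp ((c * g : M ≃ₐ[ℚ] M) : M →+* M) :=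
    RingHom.ext fun x => (hc (g x)).symm
  rw [numConjPairs, tcos, ← Set.ncard_image_of_injective _
    (Set.image_injective.2 (comp_algEquiv_injective τ))]
  congr 1
  ext s
  constructor
  · rintro ⟨⟨τ', rfl⟩, hs⟩
    obtain ⟨g, rfl⟩ := comp_algEquiv_surjective τ τ'
    refine ⟨{g, c * g}, ⟨⟨g, rfl⟩, ?_⟩, ?_⟩
    · rintro h (rfl | rfl)
      · exact hs (Or.inl rfl)
      · exact hs (Or.inr (key g).symm)
    · simp only [Set.image_pair, key]
  · rintro ⟨_, ⟨⟨g, rfl⟩, hs⟩, rfl⟩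
    refine ⟨⟨τ.comp (g : M →+* M), ?_⟩, ?_⟩
    · simp only [Set.image_pair, key]
    · exact Set.image_subset_iff.2 hs

theorem numConjPairs_Spsi {Cp : Type*} [Field Cp] (Sp : Set (M →+* Cp)) (σ : M →+* Cp)
    (ψ : Cp ≃+* ℂ) (c : M ≃ₐ[ℚ] M) (hc : ∀ x, ψ (σ (c x)) = (starRingEnd ℂ) (ψ (σ x))) :
    numConjPairs M (Spsi Cp M ψ Sp) = tcos c (Jset Cp M Sp σ) := by
  rw [numConjPairs_eq_tcos ((ψ : Cp →+* ℂ).comp σ) c hc]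
  congr 1
  ext g
  have hinj : Function.Injective fun σ : M →+* Cp => (ψ : Cp →+* ℂ).comp σ := fun _ _ h =>
    RingHom.ext fun x => ψ.injective (RingHom.congr_fun h x)
  exact not_congr (hinj.mem_set_image (s := Sp) (a := σ.comp (g : M →+* M)))

end Translate

/-- Suppose `M` is a complex (not totally real) Galois extension of `ℚ`.
Then `t = min_{c ∈ C} t_c` does not depend on the choice of `σ ∈ E_p` used to define `J_σ`,
and `v = t`, where `v = min_ψ v_ψ`. (Both assertions are captured by the statement that for
every `σ ∈ E_p`, the minimum `v` equals the minimum `t` computed from `J_σ`.) -/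
theorem stmt10 (p : ℕ) [Fact p.Prime]
    (Cp : Type*) [NormedField Cp] [CompleteSpace Cp] [IsAlgClosed Cp] [CharZero Cp]
    [Algebra ℚ_[p] Cp] (hpadic : ∀ x : ℚ_[p], ‖algebraMap ℚ_[p] Cp x‖ = ‖x‖)
    (hiso : Nonempty (Cp ≃+* ℂ))
    (M : Type*) [Field M] [NumberField M] [IsGalois ℚ M]
    (hcx : ∃ (τ : M →+* ℂ) (x : M), (τ x).im ≠ 0)
    (Sp : Set (M →+* Cp)) :
    ∀ σ : M →+* Cp,
      sInf {k : ℕ | ∃ ψ : Cp ≃+* ℂ, k = numConjPairs M (Spsi Cp M ψ Sp)} =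
        sInf {k : ℕ | ∃ c : M ≃ₐ[ℚ] M, InducedByConj M c ∧
          k = tcos c (Jset Cp M Sp σ)} := by
  intro σ
  congr 1
  ext k
  constructor
  · rintro ⟨ψ, rfl⟩
    obtain ⟨c, hc⟩ := exists_comp_eq_conj ((ψ : Cp →+* ℂ).comp σ)
    exact ⟨c, ⟨_, hc⟩, numConjPairs_Spsi Sp σ ψ c hc⟩
  · rintro ⟨c, ⟨τ, hc⟩, rfl⟩
    obtain ⟨ψ, rfl⟩ := exists_ringEquiv_comp_eq hiso.some.toEquiv σ τ
    exact ⟨ψ, (numConjPairs_Spsi Sp σ ψ c hc).symm⟩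
end

section
/- For every finite Galois extension M of ℚ there exists a weak Minkowski unit; moreover, there exists a weak Minkowski unit ε such that |σ(g(ε)) − 1|_p < 1 for all σ ∈ E_p and all g ∈ G. -/
open scoped NumberField
open Filter

open NumberField NumberField.Units NumberField.InfinitePlace in
/-- Units indexed by the infinite places, such that the unit attached to `w₁` has absolute value
less than `1` at all places other than `w₁`, generate a subgroup of maximal rank. -/
theorem isMaxRank_of_log_neg {K : Type*} [Field K] [NumberField K]
    (u : InfinitePlace K → (𝓞 K)ˣ)
    (hu : ∀ w₁ w : InfinitePlace K, w ≠ w₁ → Real.log (w (u w₁)) < 0) :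
    IsMaxRank fun i ↦ u (equivFinRank K i) := by
  classical
  have mult_pos (w : InfinitePlace K) : 0 < (w.mult : ℝ) := by
    exact_mod_cast InfinitePlace.mult_pos
  let v := fun w : {w : InfinitePlace K // w ≠ dirichletUnitTheorem.w₀} ↦
    logEmbedding K (Additive.ofMul (u w))
  suffices LinearIndependent ℝ v from
    (linearIndependent_equiv (equivFinRank K)).mpr this
  let A : Matrix {w : InfinitePlace K // w ≠ dirichletUnitTheorem.w₀}
    {w : InfinitePlace K // w ≠ dirichletUnitTheorem.w₀} ℝ := Matrix.of v
  suffices A.det ≠ 0 from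
    Matrix.linearIndependent_rows_iff_isUnit.mpr
      ((Matrix.isUnit_iff_isUnit_det A).mpr this.isUnit)
  refine det_ne_zero_of_sum_row_lt_diag fun w ↦ ?_
  have hneg : ∀ x ∈ Finset.univ.erase w, A w x < 0 := fun x hx ↦
    mul_neg_of_pos_of_neg (mult_pos _) (hu _ _ fun h ↦ Finset.ne_of_mem_erase hx (Subtype.ext h))
  have hsum : ∑ x, A w x = -(dirichletUnitTheorem.w₀ (K := K)).mult *
      Real.log (dirichletUnitTheorem.w₀ (u w : K)) :=
    dirichletUnitTheorem.sum_logEmbedding_component (u w)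
  have hw₀ := hu w dirichletUnitTheorem.w₀ w.prop.symm
  simp_rw [Real.norm_eq_abs]
  rw [Finset.sum_congr rfl fun x hx ↦ abs_of_neg (hneg x hx), Finset.sum_neg_distrib,
    Finset.sum_erase_eq_sub (Finset.mem_univ _), hsum]
  nlinarith [le_abs_self (A w w), mult_pos (dirichletUnitTheorem.w₀ (K := K))]

open NumberField NumberField.Units in
/-- A subgroup of units containing, for each infinite place `w₁`, a unit of absolute value less
than `1` at all places other than `w₁`, has finite index. -/
theorem finiteIndex_of_log_neg {K : Type*} [Field K] [NumberField K] (H : Subgroup (𝓞 K)ˣ)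
    (hH : ∀ w₁ : InfinitePlace K, ∃ u ∈ H, ∀ w : InfinitePlace K, w ≠ w₁ →
      Real.log (w (u : K)) < 0) :
    H.FiniteIndex := by
  choose u huH hu using hH
  have := isMaxRank_iff_closure_finiteIndex.mp (isMaxRank_of_log_neg u hu)
  refine Subgroup.finiteIndex_of_le
    (H := Subgroup.closure (Set.range fun i ↦ u (equivFinRank K i))) ?_
  rw [Subgroup.closure_le]
  rintro _ ⟨i, rfl⟩
  exact huH _

open NumberField in
/-- In a Galois number field, a unit of absolute value less than `1` at all infinite places but
one is a weak Minkowski unit. -/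
theorem isWeakMinkowskiUnit_of_log_neg {M : Type*} [Field M] [NumberField M] [IsGalois ℚ M]
    (ε : (𝓞 M)ˣ) (w₀ : InfinitePlace M)
    (hε : ∀ w : InfinitePlace M, w ≠ w₀ → Real.log (w (ε : M)) < 0) :
    IsWeakMinkowskiUnit M ε := by
  refine ⟨fun g ↦ Units.map (RingOfIntegers.mapRingEquiv (g : M ≃+* M)).toMonoidHom ε,
    fun g ↦ rfl, finiteIndex_of_log_neg _ fun w₁ ↦ ?_⟩
  obtain ⟨g, rfl⟩ := InfinitePlace.exists_smul_eq_of_comap_eq (k := ℚ) (w := w₀) (w' := w₁)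
    (Subsingleton.elim _ _)
  refine ⟨_, Subgroup.subset_closure ⟨g, rfl⟩, fun w hw ↦ ?_⟩
  exact hε (g⁻¹ • w) fun h ↦ hw (by rw [← h, smul_inv_smul])

open NumberField in
/-- Some positive power of a unit is congruent to `1` modulo a given nonzero integer. -/
theorem exists_pow_sub_one_eq_mul {K : Type*} [Field K] [NumberField K] (ε : (𝓞 K)ˣ)
    {n : ℕ} (hn : n ≠ 0) :
    ∃ k ≠ 0, ∃ a : 𝓞 K, (ε : 𝓞 K) ^ k - 1 = n * a := by
  let I : Ideal (𝓞 K) := Ideal.span {(n : 𝓞 K)}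
  have hI : I ≠ ⊥ := by simpa [I, Ideal.span_singleton_eq_bot] using hn
  have : Finite (𝓞 K ⧸ I) := Ring.HasFiniteQuotients.finiteQuotient hI
  refine ⟨Nat.card (𝓞 K ⧸ I)ˣ, Nat.card_pos.ne', ?_⟩
  refine Ideal.mem_span_singleton.mp ((Ideal.Quotient.mk_eq_mk_iff_sub_mem _ _).mp ?_)
  exact congrArg Units.val
    (pow_card_eq_one' (x := Units.map (Ideal.Quotient.mk I).toMonoidHom ε))

/-- Elements integral over `ℤ` have norm at most `1` in an ultrametric normed field. -/
theorem IsIntegral.norm_le_one_of_isUltrametricDist {F : Type*} [NormedField F]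
    [IsUltrametricDist F] {x : F} (hx : IsIntegral ℤ x) : ‖x‖ ≤ 1 := by
  have := (Valuation.integer.integers (NormedField.valuation (K := F))).mem_of_integral
    (hx.tower_top (A := (NormedField.valuation (K := F)).integer))
  exact this

/-- For every finite Galois extension `M` of `ℚ` there exists a weak
Minkowski unit; moreover there exists one, `ε`, with `|σ(g ε) − 1|_p < 1` for all `σ ∈ E_p`
and all `g ∈ G`. -/
theorem stmt12 (p : ℕ) [Fact p.Prime]
    (Cp : Type*) [NormedField Cp] [CompleteSpace Cp] [IsAlgClosed Cp] [CharZero Cp]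
    [Algebra ℚ_[p] Cp] (hpadic : ∀ x : ℚ_[p], ‖algebraMap ℚ_[p] Cp x‖ = ‖x‖)
    (M : Type*) [Field M] [NumberField M] [IsGalois ℚ M] :
    (∃ ε : (𝓞 M)ˣ, IsWeakMinkowskiUnit M ε) ∧
    ∃ ε : (𝓞 M)ˣ, IsWeakMinkowskiUnit M ε ∧
      ∀ (σ : M →+* Cp) (g : M ≃ₐ[ℚ] M),
        ‖σ (g (algebraMap (𝓞 M) M ε)) - 1‖ < 1 := by
  obtain ⟨ε₀, hε₀⟩ := NumberField.Units.dirichletUnitTheorem.exists_unit M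
    (Classical.arbitrary (NumberField.InfinitePlace M))
  obtain ⟨k, hk, a, ha⟩ := exists_pow_sub_one_eq_mul ε₀ (Fact.out : p.Prime).ne_zero
  have hweak : IsWeakMinkowskiUnit M (ε₀ ^ k) :=
    isWeakMinkowskiUnit_of_log_neg _ _ fun w hw ↦ by
      simpa using mul_neg_of_pos_of_neg (Nat.cast_pos.mpr hk.bot_lt) (hε₀ w hw)
  refine ⟨⟨_, hweak⟩, _, hweak, fun σ g ↦ ?_⟩
  have : IsUltrametricDist Cp :=
    IsUltrametricDist.isUltrametricDist_of_forall_norm_natCast_le_one fun n ↦ by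
      simpa using (hpadic n).trans_le (Padic.norm_int_le_one n)
  have hσ : σ (g (algebraMap (𝓞 M) M ↑(ε₀ ^ k))) - 1 = p * σ (g (algebraMap (𝓞 M) M a)) := by
    have := congrArg (fun x ↦ σ (g (algebraMap (𝓞 M) M x))) ha
    simpa using this
  have hint : IsIntegral ℤ (σ (g (algebraMap (𝓞 M) M a))) :=
    map_isIntegral_int (σ.comp (g : M →+* M)) a.isIntegral_coe
  have hp : ‖(p : Cp)‖ < 1 := by
    simpa using (hpadic p).trans_lt Padic.norm_p_lt_one
  rw [hσ, norm_mul]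
  exact mul_lt_one_of_nonneg_of_lt_one_left (norm_nonneg _) hp
    hint.norm_le_one_of_isUltrametricDist
end
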